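/- For all n ≥ 2 and all k with 1 ≤ k ≤ n, the number b(n,1,k) of ballot permutations π of {1,…,n} with exactly 1 descent and with last letter π_n = k satisfies: b(n,1,k) = 2^{k−1} if k ≤ n−2, b(n,1,n−1) = 2^{n−2} − 1, and b(n,1,n) = 2^{n−1} − 2n + 2. -/

import Mathlib

open Finset
open scoped Classical

/-- The one-line word of a permutation of `Fin n`, with values in `{1, …, n}`. -/
def permWord {n : ℕ} (π : Equiv.Perm (Fin n)) : List ℕ :=
  (List.finRange n).map fun i => (π i : ℕ) + 1

/-- The set of (0-indexed) ascent positions of a word. Position `i` (for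
`0 ≤ i ≤ length - 2`) is an ascent if `w_i < w_{i+1}`. -/
def ascentSet (w : List ℕ) : Finset ℕ :=
  (Finset.range (w.length - 1)).filter fun i => w.getD i 0 < w.getD (i + 1) 0

/-- The set of (0-indexed) descent positions of a word. Position `i` (for
`0 ≤ i ≤ length - 2`) is a descent if `w_i > w_{i+1}`. -/
def descentSet (w : List ℕ) : Finset ℕ :=
  (Finset.range (w.length - 1)).filter fun i => w.getD (i + 1) 0 < w.getD i 0

/-- The number of descents of a permutation. -/
def descentCount {n : ℕ} (π : Equiv.Perm (Fin n)) : ℕ :=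
  (descentSet (permWord π)).card

/-- A permutation is ballot if every prefix of its one-line notation has at least
as many ascents as descents. -/
def IsBallot {n : ℕ} (π : Equiv.Perm (Fin n)) : Prop :=
  ∀ k, k ≤ n →
    (descentSet ((permWord π).take k)).card ≤ (ascentSet ((permWord π).take k)).card

/-- The Eulerian number `E(n,d)`: the number of permutations of `{1,…,n}` with
exactly `d` descents.  (`E(0,0) = 1` and `E(0,d) = 0` for `d ≥ 1`.) -/
noncomputable def eulerianNum (n d : ℕ) : ℕ :=
  (Finset.univ.filter fun π : Equiv.Perm (Fin n) => descentCount π = d).card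

/-- `M(c)` for a cycle `c`: the minimum of the number of cyclic ascents and the
number of cyclic descents of `c`. -/
noncomputable def cycleM {n : ℕ} (c : Equiv.Perm (Fin n)) : ℕ :=
  min ((c.support.filter fun x => x < c x).card) ((c.support.filter fun x => c x < x).card)

/-- `M(π)`: the sum of `M(c)` over the cycles `c` of the cycle decomposition of `π`
(fixed points contribute `0`). -/
noncomputable def permM {n : ℕ} (π : Equiv.Perm (Fin n)) : ℕ :=
  ∑ c ∈ π.cycleFactorsFinset, cycleM c

/-- The number of ballot permutations of `{1,…,n}`. -/
noncomputable def ballotTotal (n : ℕ) : ℕ :=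
  (Finset.univ.filter fun π : Equiv.Perm (Fin n) => IsBallot π).card

/-- The number of permutations of `{1,…,n}` of odd order. -/
noncomputable def oddOrderTotal (n : ℕ) : ℕ :=
  (Finset.univ.filter fun π : Equiv.Perm (Fin n) => Odd (orderOf π)).card

/-- `b(n,d)`: the number of ballot permutations of `{1,…,n}` with exactly `d` descents. -/
noncomputable def bCount (n d : ℕ) : ℕ :=
  (Finset.univ.filter fun π : Equiv.Perm (Fin n) => IsBallot π ∧ descentCount π = d).card

/-- `p(n,d)`: the number of odd order permutations `π` of `{1,…,n}` with `M(π) = d`. -/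
noncomputable def pCount (n d : ℕ) : ℕ :=
  (Finset.univ.filter fun π : Equiv.Perm (Fin n) => Odd (orderOf π) ∧ permM π = d).card

/-- The Eulerian–Catalan numbers: `EC(n) = 2·E(2n, n-1)`, with `EC(0) = 1`. -/
noncomputable def eulerianCatalan (n : ℕ) : ℕ :=
  if n = 0 then 1 else 2 * eulerianNum (2 * n) (n - 1)

/-- `b(n,d,k)`: the number of ballot permutations of `{1,…,n}` with exactly `d`
descents and whose last letter is `π_n = k`. -/
noncomputable def bLast (n d k : ℕ) : ℕ :=
  (Finset.univ.filter fun π : Equiv.Perm (Fin n) =>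
    IsBallot π ∧ descentCount π = d ∧ (permWord π).getD (n - 1) 0 = k).card

/-- The only descent of `π` is the one between positions `d` and `d + 1`. -/
def IsOnlyDescent {n : ℕ} (π : Equiv.Perm (Fin n)) (d : ℕ) : Prop :=
  ∀ i (h : i + 1 < n), π ⟨i + 1, h⟩ < π ⟨i, by omega⟩ ↔ i = d

/-- The indicator function of `S`. -/
noncomputable def blockIndicator {n : ℕ} (S : Finset (Fin n)) (x : Fin n) : ℕ :=
  if x ∈ S then 1 else 0

/-- The permutation listing the complement of `S` increasingly, then `S` increasingly. -/
noncomputable def twoBlockPerm {n : ℕ} (S : Finset (Fin n)) : Equiv.Perm (Fin n) :=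
  Tuple.sort (blockIndicator S)

/-- The second blocks with greatest element `k` of ballot permutations with one descent. -/
noncomputable def secondBlocks (n : ℕ) (k : Fin n) : Finset (Finset (Fin n)) :=
  univ.filter fun S => (k ∈ S ∧ ∀ x ∈ S, x ≤ k) ∧ 2 ≤ Sᶜ.card ∧ ∃ a ∉ S, ∃ s ∈ S, s < a

lemma permWord_getD {n : ℕ} (π : Equiv.Perm (Fin n)) (i : ℕ) (h : i < n) :
    (permWord π).getD i 0 = (π ⟨i, h⟩ : ℕ) + 1 := by
  simp [permWord, List.getD, h]

lemma permWord_length {n : ℕ} (π : Equiv.Perm (Fin n)) : (permWord π).length = n := by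
  simp [permWord]

lemma permWord_take_getD {n : ℕ} (π : Equiv.Perm (Fin n)) (i k : ℕ) (hk : i < k) (h : i < n) :
    ((permWord π).take k).getD i 0 = (π ⟨i, h⟩ : ℕ) + 1 := by
  simp [permWord, List.getD, h, hk]

lemma mem_descentSet_take {n : ℕ} (π : Equiv.Perm (Fin n)) (k i : ℕ) :
    i ∈ descentSet ((permWord π).take k) ↔
      i + 1 < k ∧ ∃ h : i + 1 < n, π ⟨i + 1, h⟩ < π ⟨i, by omega⟩ := by
  simp only [descentSet, mem_filter, mem_range, List.length_take, permWord_length]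
  by_cases h : i + 1 < k ∧ i + 1 < n
  · obtain ⟨h₁, h₂⟩ := h
    rw [permWord_take_getD π i k (by omega) (by omega), permWord_take_getD π (i + 1) k h₁ h₂]
    exact ⟨fun ⟨_, h⟩ => ⟨h₁, h₂, Fin.lt_def.2 (by omega)⟩,
      fun ⟨_, _, h⟩ => ⟨by omega, by rw [Fin.lt_def] at h; omega⟩⟩
  · constructor
    · omega
    · rintro ⟨h₁, h₂, -⟩
      omega

lemma mem_ascentSet_take {n : ℕ} (π : Equiv.Perm (Fin n)) (k i : ℕ) :
    i ∈ ascentSet ((permWord π).take k) ↔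
      i + 1 < k ∧ ∃ h : i + 1 < n, π ⟨i, by omega⟩ < π ⟨i + 1, h⟩ := by
  simp only [ascentSet, mem_filter, mem_range, List.length_take, permWord_length]
  by_cases h : i + 1 < k ∧ i + 1 < n
  · obtain ⟨h₁, h₂⟩ := h
    rw [permWord_take_getD π i k (by omega) (by omega), permWord_take_getD π (i + 1) k h₁ h₂]
    exact ⟨fun ⟨_, h⟩ => ⟨h₁, h₂, Fin.lt_def.2 (by omega)⟩,
      fun ⟨_, _, h⟩ => ⟨by omega, by rw [Fin.lt_def] at h; omega⟩⟩
  · constructor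
    · omega
    · rintro ⟨h₁, h₂, -⟩
      omega

lemma mem_descentSet {n : ℕ} (π : Equiv.Perm (Fin n)) (i : ℕ) :
    i ∈ descentSet (permWord π) ↔ ∃ h : i + 1 < n, π ⟨i + 1, h⟩ < π ⟨i, by omega⟩ := by
  have h := mem_descentSet_take π n i
  rw [List.take_of_length_le (permWord_length π).le] at h
  rw [h]
  exact ⟨fun h => h.2, fun h => ⟨h.1, h⟩⟩

lemma descentCount_eq_one_iff {n : ℕ} (π : Equiv.Perm (Fin n)) :
    descentCount π = 1 ↔ ∃ d, d + 1 < n ∧ IsOnlyDescent π d := by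
  rw [descentCount, card_eq_one]
  refine exists_congr fun d => ?_
  simp only [Finset.ext_iff, mem_descentSet, mem_singleton, IsOnlyDescent]
  constructor
  · intro h
    refine ⟨((h d).2 rfl).1, fun i hi => ?_⟩
    rw [← h i]
    simp [hi]
  · rintro ⟨hd, h⟩ i
    constructor
    · rintro ⟨hi, hlt⟩
      exact (h i hi).1 hlt
    · rintro rfl
      exact ⟨hd, (h i hd).2 rfl⟩

lemma IsOnlyDescent.ascent {n : ℕ} {π : Equiv.Perm (Fin n)} {d : ℕ} (h : IsOnlyDescent π d)
    {i : ℕ} (hi : i + 1 < n) (hne : i ≠ d) : π ⟨i, by omega⟩ < π ⟨i + 1, hi⟩ := by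
  refine lt_of_le_of_ne (not_lt.1 fun hlt => hne ((h i hi).1 hlt)) fun he => ?_
  have := π.injective he
  simp at this

lemma IsOnlyDescent.isBallot_iff {n : ℕ} {π : Equiv.Perm (Fin n)} {d : ℕ} (hd : d + 1 < n)
    (h : IsOnlyDescent π d) : IsBallot π ↔ 1 ≤ d := by
  constructor
  · intro hb
    by_contra hd0
    obtain rfl : d = 0 := by omega
    have hle := hb 2 (by omega)
    have h0 : 0 ∈ descentSet ((permWord π).take 2) :=
      (mem_descentSet_take π 2 0).2 ⟨by omega, hd, (h 0 hd).2 rfl⟩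
    obtain ⟨i, hi⟩ := card_pos.1 ((card_pos.2 ⟨0, h0⟩).trans_le hle)
    obtain ⟨hi2, hin, hlt⟩ := (mem_ascentSet_take π 2 i).1 hi
    obtain rfl : i = 0 := by omega
    exact lt_asymm hlt ((h 0 hd).2 rfl)
  · intro hd1 k _
    rcases (descentSet ((permWord π).take k)).eq_empty_or_nonempty with he | ⟨i, hi⟩
    · simp [he]
    · obtain ⟨hik, hin, hlt⟩ := (mem_descentSet_take π k i).1 hi
      obtain rfl := (h i hin).1 hlt
      have hle : (descentSet ((permWord π).take k)).card ≤ 1 := by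
        refine card_le_one_iff_subset_singleton.2 ⟨i, fun j hj => ?_⟩
        obtain ⟨-, hjn, hjlt⟩ := (mem_descentSet_take π k j).1 hj
        exact mem_singleton.2 ((h j hjn).1 hjlt)
      refine hle.trans (card_pos.2 ⟨0, (mem_ascentSet_take π k 0).2 ⟨by omega, by omega, ?_⟩⟩)
      exact h.ascent (by omega) (by omega)

lemma isBallot_and_descentCount_eq_one_iff {n : ℕ} (π : Equiv.Perm (Fin n)) :
    IsBallot π ∧ descentCount π = 1 ↔ ∃ d, 1 ≤ d ∧ d + 1 < n ∧ IsOnlyDescent π d := by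
  rw [descentCount_eq_one_iff]
  constructor
  · rintro ⟨hb, d, hd, h⟩
    exact ⟨d, (h.isBallot_iff hd).1 hb, hd, h⟩
  · rintro ⟨d, hd1, hd, h⟩
    exact ⟨(h.isBallot_iff hd).2 hd1, d, hd, h⟩

/-- Positive steps on an interval of positions give strict monotonicity there. -/
lemma perm_lt_of_forall_succ {n : ℕ} (π : Equiv.Perm (Fin n)) (i : ℕ) :
    ∀ j (hj : j < n) (_ : i < j),
      (∀ l, i ≤ l → ∀ h : l + 1 < n, l < j → π ⟨l, by omega⟩ < π ⟨l + 1, h⟩) →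
      π ⟨i, by omega⟩ < π ⟨j, hj⟩ := by
  intro j
  induction j with
  | zero => intro _ h; omega
  | succ j ih =>
    intro hj hij hstep
    have hlast := hstep j (by omega) hj (by omega)
    rcases Nat.lt_or_ge i j with hlt | hge
    · exact (ih (by omega) hlt fun l hl h hlj => hstep l hl h (by omega)).trans hlast
    · obtain rfl : i = j := by omega
      exact hlast

lemma eq_twoBlockPerm_iff {n : ℕ} (π : Equiv.Perm (Fin n)) (S : Finset (Fin n)) :
    π = twoBlockPerm S ↔ (∀ i j, i ≤ j → π i ∈ S → π j ∈ S) ∧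
      ∀ i j, i < j → (π i ∈ S ↔ π j ∈ S) → π i < π j := by
  rw [twoBlockPerm, Tuple.eq_sort_iff]
  refine and_congr ?_ ?_
  · refine forall₃_congr fun i j _ => ?_
    simp only [Function.comp, blockIndicator]
    split_ifs <;> simp_all
  · refine forall₃_congr fun i j _ => ?_
    simp only [blockIndicator]
    split_ifs <;> simp_all

lemma IsOnlyDescent.eq_twoBlockPerm {n : ℕ} {π : Equiv.Perm (Fin n)} {d : ℕ}
    (h : IsOnlyDescent π d) {S : Finset (Fin n)} (hS : ∀ i, π i ∈ S ↔ d < (i : ℕ)) :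
    π = twoBlockPerm S := by
  refine (eq_twoBlockPerm_iff π S).2 ⟨fun i j hij => ?_, fun i j hij => ?_⟩
  · rw [hS, hS]
    exact fun hi => hi.trans_le hij
  · rw [hS, hS]
    intro hiff
    exact perm_lt_of_forall_succ π i j j.2 hij fun l hl hln hlj => h.ascent hln (by omega)

lemma exists_isOnlyDescent_twoBlockPerm {n : ℕ} {k : Fin n} {S : Finset (Fin n)}
    (hS : S ∈ secondBlocks n k) :
    ∃ d, 1 ≤ d ∧ d + 1 < n ∧ IsOnlyDescent (twoBlockPerm S) d ∧
      ∀ i, twoBlockPerm S i ∈ S ↔ d < (i : ℕ) := by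
  obtain ⟨hmono, htie⟩ := (eq_twoBlockPerm_iff _ S).1 rfl
  generalize twoBlockPerm S = π at *
  simp only [secondBlocks, mem_filter, mem_univ, true_and] at hS
  obtain ⟨⟨hk, -⟩, hcard, a, ha, s, hs, hsa⟩ := hS
  have hex : ∃ m, ∃ hm : m < n, π ⟨m, hm⟩ ∈ S := ⟨π.symm k, (π.symm k).2, by simpa using hk⟩
  set m := Nat.find hex
  obtain ⟨hmn, hmS⟩ := Nat.find_spec hex
  have hmem : ∀ i : Fin n, π i ∈ S ↔ m ≤ (i : ℕ) := fun i =>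
    ⟨fun hi => Nat.find_min' hex ⟨i.2, hi⟩, fun hi => hmono ⟨m, hmn⟩ i hi hmS⟩
  have hm2 : 2 ≤ m := by
    refine hcard.trans ?_
    have hsub : Sᶜ ⊆ (Finset.Iio (⟨m, hmn⟩ : Fin n)).image π := by
      intro x hx
      refine mem_image.2 ⟨π.symm x, mem_Iio.2 (Fin.lt_def.2 (not_le.1 fun hle => ?_)), by simp⟩
      exact mem_compl.1 hx (by simpa using (hmem (π.symm x)).2 hle)
    simpa using (card_le_card hsub).trans card_image_le
  have hasc : ∀ l, l + 1 ≠ m → ∀ h : l + 1 < n, π ⟨l, by omega⟩ < π ⟨l + 1, h⟩ := by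
    intro l hl h
    refine htie _ _ (by simp [Fin.lt_def]) ?_
    rw [hmem, hmem]
    simp only
    omega
  refine ⟨m - 1, by omega, by omega, fun i hi => ⟨fun hlt => ?_, ?_⟩, fun i => ?_⟩
  · by_contra hne
    exact lt_asymm hlt (hasc i (by omega) hi)
  · intro him
    by_contra hnot
    have hstep : π ⟨i, by omega⟩ < π ⟨i + 1, hi⟩ := by
      refine lt_of_le_of_ne (not_lt.1 hnot) fun he => ?_
      have := π.injective he
      simp at this
    have hai : ((π.symm a : Fin n) : ℕ) < m := by
      have := hmem (π.symm a)
      simp only [Equiv.apply_symm_apply, ha, false_iff] at this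
      omega
    have hsi : m ≤ ((π.symm s : Fin n) : ℕ) := by
      have := hmem (π.symm s)
      simpa [hs] using this
    have hlt := perm_lt_of_forall_succ π (π.symm a) (π.symm s) (π.symm s).2 (by omega)
      fun l _ hl _ => by
        by_cases hlm : l + 1 = m
        · obtain rfl : l = i := by omega
          exact hstep
        · exact hasc l hlm hl
    simp only [Fin.eta, Equiv.apply_symm_apply] at hlt
    exact lt_asymm hsa hlt
  · rw [hmem]
    omega

lemma twoBlockPerm_injOn (n : ℕ) (k : Fin n) :
    Set.InjOn twoBlockPerm (secondBlocks n k : Set (Finset (Fin n))) := by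
  intro S hS T hT he
  obtain ⟨d, -, hd, hdS, hmS⟩ := exists_isOnlyDescent_twoBlockPerm (mem_coe.1 hS)
  obtain ⟨e, -, -, heT, hmT⟩ := exists_isOnlyDescent_twoBlockPerm (mem_coe.1 hT)
  rw [← he] at heT hmT
  obtain rfl : d = e := (heT d hd).1 ((hdS d hd).2 rfl)
  ext x
  have := (hmS ((twoBlockPerm S).symm x)).trans (hmT ((twoBlockPerm S).symm x)).symm
  simpa using this

lemma ballot_filter_eq_image (n : ℕ) (k : Fin n) :
    (univ.filter fun π : Equiv.Perm (Fin n) =>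
      IsBallot π ∧ descentCount π = 1 ∧ (permWord π).getD (n - 1) 0 = (k : ℕ) + 1) =
      (secondBlocks n k).image twoBlockPerm := by
  have hn : n - 1 < n := by have := k.2; omega
  ext π
  simp only [mem_filter, mem_univ, true_and, mem_image]
  rw [← and_assoc, isBallot_and_descentCount_eq_one_iff, permWord_getD π _ hn]
  constructor
  · rintro ⟨⟨d, hd1, hd, h⟩, hk⟩
    have hk : π ⟨n - 1, hn⟩ = k := Fin.ext (by omega)
    set S : Finset (Fin n) := (univ.filter fun i : Fin n => d < (i : ℕ)).image π with hSdef
    have hS : ∀ i, π i ∈ S ↔ d < (i : ℕ) := by simp [hSdef]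
    refine ⟨S, ?_, (h.eq_twoBlockPerm hS).symm⟩
    simp only [secondBlocks, mem_filter, mem_univ, true_and]
    refine ⟨⟨?_, ?_⟩, ?_, π ⟨d, by omega⟩, ?_, π ⟨d + 1, hd⟩, ?_, (h d hd).2 rfl⟩
    · rw [← hk, hS]
      simp only
      omega
    · intro x hx
      obtain ⟨i, rfl⟩ := π.surjective x
      rw [hS] at hx
      rw [← hk]
      rcases Nat.lt_or_ge i (n - 1) with hlt | hge
      · exact (perm_lt_of_forall_succ π i (n - 1) hn hlt fun l hl hln _ =>
          h.ascent hln (by omega)).le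
      · exact (congrArg π (Fin.ext (by have := i.2; simp only; omega))).le
    · refine Finset.one_lt_card.2 ⟨π ⟨0, by omega⟩, ?_, π ⟨1, by omega⟩, ?_, ?_⟩
      · rw [mem_compl, hS]; simp
      · rw [mem_compl, hS]; simp only; omega
      · simp
    · rw [hS]; simp
    · rw [hS]; simp
  · rintro ⟨S, hS, rfl⟩
    obtain ⟨d, hd1, hd, h, hmem⟩ := exists_isOnlyDescent_twoBlockPerm hS
    refine ⟨⟨d, hd1, hd, h⟩, ?_⟩
    simp only [secondBlocks, mem_filter, mem_univ, true_and] at hS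
    obtain ⟨-, htie⟩ := (eq_twoBlockPerm_iff _ S).1 rfl
    generalize twoBlockPerm S = π at *
    have hlast : π ⟨n - 1, hn⟩ ∈ S := (hmem _).2 (by simp only; omega)
    have hle : k ≤ π ⟨n - 1, hn⟩ := by
      obtain ⟨i, hi⟩ := π.surjective k
      rcases Nat.lt_or_ge i (n - 1) with hlt | hge
      · rw [← hi]
        exact (htie i _ hlt (by simp [hi, hS.1.1, hlast])).le
      · rw [← hi]
        exact (congrArg π (Fin.ext (by have := i.2; simp only; omega))).le
    rw [le_antisymm (hS.1.2 _ hlast) hle]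

lemma bLast_one_eq_card_secondBlocks (n : ℕ) (k : Fin n) :
    bLast n 1 (k + 1) = (secondBlocks n k).card := by
  rw [bLast, ballot_filter_eq_image, card_image_of_injOn (twoBlockPerm_injOn n k)]

/-- The sets with greatest element `k`. -/
noncomputable def setsWithMax {n : ℕ} (k : Fin n) : Finset (Finset (Fin n)) :=
  univ.filter fun S => k ∈ S ∧ ∀ x ∈ S, x ≤ k

lemma card_setsWithMax {n : ℕ} (k : Fin n) : (setsWithMax k).card = 2 ^ (k : ℕ) := by
  have h : setsWithMax k = (Finset.Iio k).powerset.image (insert k) := by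
    ext S
    simp only [setsWithMax, mem_filter, mem_univ, true_and, mem_image, mem_powerset]
    constructor
    · rintro ⟨hk, hS⟩
      refine ⟨S.erase k, fun x hx => ?_, insert_erase hk⟩
      rw [mem_erase] at hx
      exact mem_Iio.2 (lt_of_le_of_ne (hS x hx.2) hx.1)
    · rintro ⟨T, hT, rfl⟩
      refine ⟨mem_insert_self _ _, fun x hx => ?_⟩
      rcases mem_insert.1 hx with rfl | hx
      · exact le_rfl
      · exact (mem_Iio.1 (hT hx)).le
  rw [h, card_image_of_injOn, card_powerset, Fin.card_Iio]
  intro S hS T hT he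
  have hnot : ∀ U ∈ (Finset.Iio k).powerset, k ∉ U := fun U hU hk =>
    lt_irrefl k (mem_Iio.1 (mem_powerset.1 hU hk))
  rw [← erase_insert (hnot S hS), ← erase_insert (hnot T hT)]
  exact congrArg (fun U => erase U k) he

lemma card_secondBlocks_of_lt (N : ℕ) (k : Fin (N + 2)) (hk : (k : ℕ) < N) :
    (secondBlocks (N + 2) k).card = 2 ^ (k : ℕ) := by
  rw [← card_setsWithMax]
  congr 1
  ext S
  simp only [secondBlocks, setsWithMax, mem_filter, mem_univ, true_and, and_iff_left_iff_imp]
  rintro ⟨hkS, hS⟩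
  have hnot : ∀ x : Fin (N + 2), N ≤ (x : ℕ) → x ∉ S := fun x hx hxS => by
    have := Fin.le_def.1 (hS x hxS)
    omega
  refine ⟨one_lt_card.2 ⟨⟨N, by omega⟩, ?_, ⟨N + 1, by omega⟩, ?_, ?_⟩,
    ⟨N, by omega⟩, hnot _ le_rfl, k, hkS, hk⟩
  · exact mem_compl.2 (hnot _ le_rfl)
  · exact mem_compl.2 (hnot _ (by simp))
  · simp

lemma card_secondBlocks_of_eq (N : ℕ) (k : Fin (N + 2)) (hk : (k : ℕ) = N) :
    (secondBlocks (N + 2) k).card = 2 ^ N - 1 := by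
  have h : secondBlocks (N + 2) k = (setsWithMax k).erase (Finset.Iic k) := by
    ext S
    simp only [secondBlocks, setsWithMax, mem_filter, mem_univ, true_and, mem_erase]
    constructor
    · rintro ⟨hS, hcard, -⟩
      refine ⟨?_, hS⟩
      rintro rfl
      rw [card_compl, Fin.card_Iic, Fintype.card_fin] at hcard
      omega
    · rintro ⟨hne, hkS, hS⟩
      have hlast : Fin.last (N + 1) ∉ S := fun hmem => by
        have := Fin.le_def.1 (hS _ hmem)
        simp at this
        omega
      refine ⟨⟨hkS, hS⟩, ?_, Fin.last _, hlast, k, hkS, by rw [Fin.lt_def]; simp; omega⟩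
      obtain ⟨x, hxk, hxS⟩ : ∃ x ≤ k, x ∉ S := by
        by_contra! hcon
        exact hne (Finset.ext fun x => ⟨fun hx => mem_Iic.2 (hS x hx), fun hx =>
          hcon x (mem_Iic.1 hx)⟩)
      refine one_lt_card.2 ⟨x, mem_compl.2 hxS, Fin.last _, mem_compl.2 hlast, ?_⟩
      rintro rfl
      have := Fin.le_def.1 hxk
      simp at this
      omega
  rw [h, card_erase_of_mem (by simp [setsWithMax]), card_setsWithMax, hk]

/-- The sets containing the last element that are not second blocks are the final segments and
the complements of a single interior element. -/
lemma secondBlocks_last (N : ℕ) :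
    secondBlocks (N + 2) (Fin.last (N + 1)) = setsWithMax (Fin.last (N + 1)) \
      (univ.image (fun m : Fin (N + 2) => Finset.Ici m) ∪
        (Finset.Ioo 0 (Fin.last (N + 1))).image fun a => ({a} : Finset (Fin (N + 2)))ᶜ) := by
  ext S
  simp only [secondBlocks, setsWithMax, mem_filter, mem_univ, true_and, mem_sdiff, mem_union,
    mem_image, mem_Ioo, not_or, not_exists, not_and]
  refine and_congr_right fun hS => ?_
  constructor
  · rintro ⟨hcard, a, ha, s, hs, hsa⟩
    refine ⟨?_, ?_⟩
    · rintro m rfl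
      exact ha (mem_Ici.2 ((mem_Ici.1 hs).trans hsa.le))
    · rintro x - rfl
      simp at hcard
  · rintro ⟨hIci, hcompl⟩
    have hdesc : ∃ a ∉ S, ∃ s ∈ S, s < a := by
      by_contra! hcon
      refine hIci (S.min' ⟨_, hS.1⟩) (Finset.ext fun x => ?_)
      rw [mem_Ici]
      refine ⟨fun hx => ?_, fun hx => S.min'_le x hx⟩
      by_contra hxS
      have := le_antisymm hx (hcon x hxS _ (S.min'_mem ⟨_, hS.1⟩))
      exact hxS (this ▸ S.min'_mem ⟨_, hS.1⟩)
    refine ⟨?_, hdesc⟩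
    obtain ⟨a, ha, s, hs, hsa⟩ := hdesc
    by_contra hcard
    have hone : Sᶜ.card = 1 := by
      have := card_pos.2 ⟨a, mem_compl.2 ha⟩
      omega
    obtain ⟨b, hb⟩ := card_eq_one.1 hone
    obtain rfl : a = b := mem_singleton.1 (hb ▸ mem_compl.2 ha)
    refine hcompl a ⟨(Fin.zero_le s).trans_lt hsa, Fin.lt_last_iff_ne_last.2 ?_⟩ ?_
    · rintro rfl
      exact ha hS.1
    · rw [← hb, compl_compl]

lemma card_secondBlocks_last (N : ℕ) :
    (secondBlocks (N + 2) (Fin.last (N + 1))).card + (2 * N + 2) = 2 ^ (N + 1) := by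
  have hdisj : Disjoint (univ.image (fun m : Fin (N + 2) => Finset.Ici m))
      ((Finset.Ioo 0 (Fin.last (N + 1))).image fun a => ({a} : Finset (Fin (N + 2)))ᶜ) := by
    rw [Finset.disjoint_left]
    intro S hS hS'
    obtain ⟨m, -, rfl⟩ := mem_image.1 hS
    obtain ⟨a, ha, he⟩ := mem_image.1 hS'
    have h0 : (0 : Fin (N + 2)) ∈ Finset.Ici m := by
      rw [← he]
      simpa using (mem_Ioo.1 ha).1.ne
    have hmem : a ∈ Finset.Ici m := mem_Ici.2 ((mem_Ici.1 h0).trans (Fin.zero_le a))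
    rw [← he] at hmem
    simp at hmem
  have hsub : univ.image (fun m : Fin (N + 2) => Finset.Ici m) ∪
      ((Finset.Ioo 0 (Fin.last (N + 1))).image fun a => ({a} : Finset (Fin (N + 2)))ᶜ) ⊆
      setsWithMax (Fin.last (N + 1)) := by
    intro S hS
    simp only [setsWithMax, mem_filter, mem_univ, true_and]
    refine ⟨?_, fun x _ => Fin.le_last x⟩
    rcases mem_union.1 hS with h | h
    · obtain ⟨m, -, rfl⟩ := mem_image.1 h
      exact mem_Ici.2 (Fin.le_last m)
    · obtain ⟨a, ha, rfl⟩ := mem_image.1 h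
      simpa using (mem_Ioo.1 ha).2.ne'
  have hIci : Function.Injective fun m : Fin (N + 2) => Finset.Ici m := fun a b he =>
    le_antisymm (mem_Ici.1 ((Finset.ext_iff.1 he b).2 (mem_Ici.2 le_rfl)))
      (mem_Ici.1 ((Finset.ext_iff.1 he a).1 (mem_Ici.2 le_rfl)))
  have hcompl : Function.Injective fun a : Fin (N + 2) => ({a} : Finset (Fin (N + 2)))ᶜ :=
    compl_injective.comp singleton_injective
  have hcard := card_sdiff_add_card_eq_card hsub
  rw [← secondBlocks_last, card_union_of_disjoint hdisj, card_setsWithMax,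
    card_image_of_injective _ hIci,
    card_image_of_injective _ hcompl] at hcard
  simp at hcard
  omega

theorem ballot_one_descent_last_letter (n : ℕ) (hn : 2 ≤ n) (k : ℕ)
    (hk1 : 1 ≤ k) (hkn : k ≤ n) :
    (k ≤ n - 2 → bLast n 1 k = 2 ^ (k - 1)) ∧
      (k = n - 1 → bLast n 1 k = 2 ^ (n - 2) - 1) ∧
      (k = n → (bLast n 1 k : ℤ) = 2 ^ (n - 1) - 2 * n + 2) := by
  obtain ⟨N, rfl⟩ := Nat.exists_eq_add_of_le' hn
  obtain ⟨j, rfl⟩ := Nat.exists_eq_add_of_le' hk1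
  have hb := bLast_one_eq_card_secondBlocks (N + 2) ⟨j, by omega⟩
  simp only at hb
  rw [hb]
  refine ⟨fun h => ?_, fun h => ?_, fun h => ?_⟩
  · exact card_secondBlocks_of_lt N _ (by simp only; omega)
  · exact card_secondBlocks_of_eq N _ (by simp only; omega)
  · obtain rfl : j = N + 1 := by omega
    have hcard := card_secondBlocks_last N
    have hcast : ((secondBlocks (N + 2) (Fin.last (N + 1))).card : ℤ) + (2 * N + 2) =
        2 ^ (N + 1) := by exact_mod_cast hcard
    change ((secondBlocks (N + 2) (Fin.last (N + 1))).card : ℤ) = 2 ^ (N + 1) - 2 * _ + 2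
    push_cast
    linarith
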